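/- arXiv:1802.03948 — 3 statements merged into one kernel-verified Lean document; each statement's English description precedes it below -/
import Mathlib

section
/- For all real x with −1 ≤ x ≤ 1 and all n ≥ 0, the derivative of the Legendre polynomial satisfies |P_n'(x)| ≤ n(n+1)/2. -/
open Polynomial in
noncomputable def legendre : ℕ → Polynomial ℝ
  | 0 => 1
  | 1 => X
  | (n + 2) =>
      C ((2 * (n : ℝ) + 3) / ((n : ℝ) + 2)) * (X * legendre (n + 1))
        - C (((n : ℝ) + 1) / ((n : ℝ) + 2)) * legendre n

open Polynomial in
/-- Bonnet's recursion, evaluated at a point and with denominators cleared. -/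
theorem legendre_eval_add_two (n : ℕ) (x : ℝ) :
    ((n : ℝ) + 2) * (legendre (n + 2)).eval x =
      (2 * (n : ℝ) + 3) * (x * (legendre (n + 1)).eval x)
        - ((n : ℝ) + 1) * (legendre n).eval x := by
  have h : (n : ℝ) + 2 ≠ 0 := by positivity
  simp only [legendre, eval_sub, eval_mul, eval_C, eval_X]
  field_simp

open Polynomial in
theorem legendre_derivative_eval_add_two (n : ℕ) (x : ℝ) :
    ((n : ℝ) + 2) * (derivative (legendre (n + 2))).eval x =
      (2 * (n : ℝ) + 3) *
          ((legendre (n + 1)).eval x + x * (derivative (legendre (n + 1))).eval x)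
        - ((n : ℝ) + 1) * (derivative (legendre n)).eval x := by
  have h : (n : ℝ) + 2 ≠ 0 := by positivity
  simp only [legendre, derivative_sub, derivative_mul, derivative_C, derivative_X, eval_sub,
    eval_add, eval_mul, eval_C, eval_X, zero_mul, zero_add, one_mul]
  field_simp

open Polynomial in
theorem legendre_derivative_eval_succ (n : ℕ) (x : ℝ) :
    (derivative (legendre (n + 1))).eval x =
        x * (derivative (legendre n)).eval x + ((n : ℝ) + 1) * (legendre n).eval x ∧
      x * (derivative (legendre (n + 1))).eval x =
        (derivative (legendre n)).eval x + ((n : ℝ) + 1) * (legendre (n + 1)).eval x := by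
  induction n with
  | zero => simp [legendre]
  | succ n ih =>
    obtain ⟨hA, hB⟩ := ih
    have h : (n : ℝ) + 2 ≠ 0 := by positivity
    have hp := legendre_eval_add_two n x
    have hd := legendre_derivative_eval_add_two n x
    have hA' : (derivative (legendre (n + 2))).eval x =
        x * (derivative (legendre (n + 1))).eval x
          + ((n : ℝ) + 2) * (legendre (n + 1)).eval x := by
      apply mul_left_cancel₀ h
      linear_combination hd + ((n : ℝ) + 1) * hB
    push_cast
    constructor
    · linear_combination hA'
    · linear_combination x * hA' - hp + x * hB - hA

open Polynomial in
theorem legendre_derivative_eval_add_two_sub (n : ℕ) (x : ℝ) :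
    (derivative (legendre (n + 2))).eval x =
      (derivative (legendre n)).eval x + (2 * (n : ℝ) + 3) * (legendre (n + 1)).eval x := by
  have hA := (legendre_derivative_eval_succ (n + 1) x).1
  have hB := (legendre_derivative_eval_succ n x).2
  push_cast at hA
  linear_combination hA + hB

open Polynomial in
/-- The left-hand side is `P_{n+1}² + P_n² - 2 x P_n P_{n+1}`, which is nonincreasing in `n`. -/
theorem legendre_consecutive_sq_le (n : ℕ) (x : ℝ) :
    (1 - x ^ 2) * (legendre n).eval x ^ 2
      + ((legendre (n + 1)).eval x - x * (legendre n).eval x) ^ 2 ≤ 1 - x ^ 2 := by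
  induction n with
  | zero => simp [legendre]
  | succ n ih =>
    have h : (n : ℝ) + 2 ≠ 0 := by positivity
    have hstep : (legendre (n + 2)).eval x - x * (legendre (n + 1)).eval x =
        ((n : ℝ) + 1) / ((n : ℝ) + 2)
          * (x * (legendre (n + 1)).eval x - (legendre n).eval x) := by
      field_simp
      linear_combination legendre_eval_add_two n x
    have ha0 : 0 ≤ ((n : ℝ) + 1) / ((n : ℝ) + 2) := by positivity
    have ha1 : ((n : ℝ) + 1) / ((n : ℝ) + 2) ≤ 1 := by
      rw [div_le_one (by positivity)]
      linarith
    have hsq := mul_le_of_le_one_left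
      (sq_nonneg (x * (legendre (n + 1)).eval x - (legendre n).eval x))
      (pow_le_one₀ ha0 ha1 (n := 2))
    rw [hstep, mul_pow]
    linarith

open Polynomial in
theorem abs_legendre_eval_le_one (n : ℕ) (x : ℝ) (hx : x ^ 2 ≤ 1) :
    |(legendre n).eval x| ≤ 1 := by
  rw [← sq_le_one_iff_abs_le_one]
  rcases hx.lt_or_eq with hlt | heq
  · have h := legendre_consecutive_sq_le n x
    have hs := sq_nonneg ((legendre (n + 1)).eval x - x * (legendre n).eval x)
    refine le_of_mul_le_mul_left ?_ (sub_pos.mpr hlt)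
    linarith
  · induction n with
    | zero => simp [legendre]
    | succ n ih =>
      have h := legendre_consecutive_sq_le n x
      rw [heq, sub_self, zero_mul, zero_add] at h
      have h0 := pow_eq_zero_iff two_ne_zero |>.mp (le_antisymm h (sq_nonneg _))
      rw [sub_eq_zero.mp h0, mul_pow, heq, one_mul]
      exact ih

open Polynomial in
/-- Bound for the derivative of the Legendre polynomial on [-1,1]. -/
theorem legendre_deriv_bound (n : ℕ) (x : ℝ) (hx : -1 ≤ x) (hx' : x ≤ 1) :
    |(derivative (legendre n)).eval x| ≤ (n : ℝ) * ((n : ℝ) + 1) / 2 := by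
  induction n using Nat.twoStepInduction with
  | zero => simp [legendre]
  | one => simp [legendre]
  | more n ih _ =>
    have hp := abs_legendre_eval_le_one (n + 1) x (by nlinarith)
    have hn : (0 : ℝ) ≤ 2 * (n : ℝ) + 3 := by positivity
    rw [legendre_derivative_eval_add_two_sub]
    refine (abs_add_le _ _).trans ?_
    rw [abs_mul, abs_of_nonneg hn]
    have hm := mul_le_of_le_one_right hn hp
    push_cast
    linarith
end

section
/- For all real x with −1 < x < 1 and all n ≥ 1, |P_n''(x)| ≤ (2^{5/2}/√π) · n^{3/2} / (1 − x²)^{5/4}. -/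
open Polynomial in
/-- The pair of first-order relations between consecutive Legendre polynomials. -/
theorem legendre_derivative_succ (n : ℕ) :
    derivative (legendre (n + 1)) =
        X * derivative (legendre n) + C ((n : ℝ) + 1) * legendre n ∧
      X * derivative (legendre (n + 1)) =
        derivative (legendre n) + C ((n : ℝ) + 1) * legendre (n + 1) := by
  induction n with
  | zero => simp [legendre]
  | succ n ih =>
    obtain ⟨hA, hB⟩ := ih
    have hn : (n : ℝ) + 2 ≠ 0 := by positivity
    have hrec : C ((n : ℝ) + 2) * legendre (n + 2) =
        C (2 * (n : ℝ) + 3) * (X * legendre (n + 1)) - C ((n : ℝ) + 1) * legendre n := by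
      rw [legendre, mul_sub, ← mul_assoc (C _) (C _), ← mul_assoc (C _) (C _), ← C_mul,
        ← C_mul, mul_div_cancel₀ _ hn, mul_div_cancel₀ _ hn]
    have hder := congrArg derivative hrec
    simp only [derivative_mul, derivative_sub, derivative_C, derivative_X, zero_mul, zero_add,
      one_mul] at hder
    have hC : (C ((n : ℝ) + 2) : ℝ[X]) ≠ 0 := C_ne_zero.2 hn
    have hA' : derivative (legendre (n + 2)) =
        X * derivative (legendre (n + 1)) + C ((n : ℝ) + 2) * legendre (n + 1) := by
      apply mul_left_cancel₀ hC
      simp only [C_add, C_mul] at *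
      have e1 : (C (2 : ℝ) : ℝ[X]) = 2 := rfl
      have e2 : (C (3 : ℝ) : ℝ[X]) = 3 := rfl
      simp only [e1, e2, C_1] at *
      linear_combination hder + (C (n : ℝ) + 1) * hB
    have e1 : (C (2 : ℝ) : ℝ[X]) = 2 := rfl
    have e2 : (C (3 : ℝ) : ℝ[X]) = 3 := rfl
    simp only [Nat.cast_add, Nat.cast_one, C_add, C_mul, e1, e2, C_1] at *
    refine ⟨by linear_combination hA', ?_⟩
    linear_combination X * hA' - hrec + X * hB - hA

open Polynomial in
/-- The Legendre differential equation. -/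
theorem legendre_ode (n : ℕ) :
    (X ^ 2 - 1) * derivative (derivative (legendre n)) + 2 * X * derivative (legendre n) =
      C ((n : ℝ) * (n + 1)) * legendre n := by
  cases n with
  | zero => simp [legendre]
  | succ n =>
    obtain ⟨hA, hB⟩ := legendre_derivative_succ n
    have h : (X ^ 2 - 1) * derivative (legendre (n + 1)) =
        C ((n : ℝ) + 1) * (X * legendre (n + 1) - legendre n) := by
      linear_combination X * hB - hA
    have hder := congrArg derivative h
    simp only [derivative_mul, derivative_sub, derivative_C, derivative_X, derivative_X_pow,
      derivative_one, zero_mul, zero_add, one_mul] at hder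
    have e1 : (C (2 : ℝ) : ℝ[X]) = 2 := rfl
    simp only [Nat.cast_add, Nat.cast_one, Nat.cast_ofNat, C_add, C_mul, e1, C_1,
      Nat.add_one_sub_one, pow_one] at *
    linear_combination hder + (C (n : ℝ) + 1) * hB

open Polynomial in
theorem eval_legendre_ode (n : ℕ) (x : ℝ) :
    (x ^ 2 - 1) * (derivative (derivative (legendre n))).eval x
        + 2 * x * (derivative (legendre n)).eval x =
      (n : ℝ) * (n + 1) * (legendre n).eval x := by
  simpa using congrArg (eval x) (legendre_ode n)

open Polynomial in
theorem eval_derivative_legendre_ode (n : ℕ) (x : ℝ) :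
    (x ^ 2 - 1) * (derivative (derivative (derivative (legendre n)))).eval x
        + 4 * x * (derivative (derivative (legendre n))).eval x =
      ((n : ℝ) * (n + 1) - 2) * (derivative (legendre n)).eval x := by
  have h := congrArg (fun p => (derivative p).eval x) (legendre_ode n)
  simp at h
  linear_combination h

open Polynomial in
theorem eval_derivative_derivative_legendre_ode (n : ℕ) (x : ℝ) :
    (x ^ 2 - 1) * (derivative (derivative (derivative (derivative (legendre n))))).eval x
        + 6 * x * (derivative (derivative (derivative (legendre n)))).eval x =
      ((n : ℝ) * (n + 1) - 6) * (derivative (derivative (legendre n))).eval x := by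
  have h := congrArg (fun p => (derivative (derivative p)).eval x) (legendre_ode n)
  simp at h
  linear_combination h

open Polynomial in
theorem eval_legendre_add_two (n : ℕ) (x : ℝ) :
    (legendre (n + 2)).eval x =
      (2 * (n : ℝ) + 3) / (n + 2) * (x * (legendre (n + 1)).eval x)
        - ((n : ℝ) + 1) / (n + 2) * (legendre n).eval x := by
  simp [legendre]

open Polynomial in
theorem eval_legendre_of_sq_eq_one {x : ℝ} (hx : x ^ 2 = 1) (n : ℕ) :
    (legendre n).eval x = x ^ n := by
  induction n using Nat.twoStepInduction with
  | zero => simp [legendre]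
  | one => simp [legendre]
  | more n h0 h1 =>
    have hn : (n : ℝ) + 2 ≠ 0 := by positivity
    rw [eval_legendre_add_two, h0, h1]
    field_simp
    linear_combination x ^ n * ((n : ℝ) + 1) * hx

open Polynomial in
theorem sq_eval_zero_legendre_le (n : ℕ) :
    (legendre n).eval 0 ^ 2 ≤ 1 / ((n : ℝ) + 1) := by
  induction n using Nat.twoStepInduction with
  | zero => simp [legendre]
  | one => simp [legendre]
  | more n h0 _ =>
    rw [eval_legendre_add_two]
    push_cast
    calc _ = (((n : ℝ) + 1) / (n + 2)) ^ 2 * (legendre n).eval 0 ^ 2 := by ring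
      _ ≤ (((n : ℝ) + 1) / (n + 2)) ^ 2 * (1 / ((n : ℝ) + 1)) := by gcongr
      _ = ((n : ℝ) + 1) / (n + 2) ^ 2 := by field_simp
      _ ≤ 1 / ((n : ℝ) + 2 + 1) := by
        rw [div_le_div_iff₀ (by positivity) (by positivity)]
        nlinarith

theorem le_eval_endpoint_of_hasDerivAt_id_mul {f g : ℝ → ℝ}
    (hf : ∀ t, HasDerivAt f (t * g t) t) (hg : ∀ t, 0 ≤ g t) {x : ℝ}
    (hx : -1 ≤ x) (hx' : x ≤ 1) : f x ≤ f 1 ∨ f x ≤ f (-1) := by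
  have hc : Continuous f := continuous_iff_continuousAt.2 fun t => (hf t).continuousAt
  rcases le_total 0 x with h | h
  · left
    refine monotoneOn_of_hasDerivWithinAt_nonneg (convex_Ici 0) hc.continuousOn
      (fun t _ => (hf t).hasDerivWithinAt) (fun t ht => ?_) h (Set.mem_Ici.2 zero_le_one) hx'
    rw [interior_Ici] at ht
    exact mul_nonneg (le_of_lt ht) (hg t)
  · right
    refine antitoneOn_of_hasDerivWithinAt_nonpos (convex_Iic 0) hc.continuousOn
      (fun t _ => (hf t).hasDerivWithinAt) (fun t ht => ?_) (by simp) h hx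
    rw [interior_Iic] at ht
    exact mul_nonpos_of_nonpos_of_nonneg (le_of_lt ht) (hg t)

theorem le_eval_zero_of_hasDerivAt_neg_id_mul {f g : ℝ → ℝ}
    (hf : ∀ t ∈ Set.Ioo (-1 : ℝ) 1, HasDerivAt f (-t * g t) t) (hg : ∀ t, 0 ≤ g t) {x : ℝ}
    (hx : -1 < x) (hx' : x < 1) : f x ≤ f 0 := by
  rcases le_total 0 x with h | h
  · have hsub : Set.Ico (0 : ℝ) 1 ⊆ Set.Ioo (-1) 1 := fun t ht => ⟨by linarith [ht.1], ht.2⟩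
    refine antitoneOn_of_hasDerivWithinAt_nonpos (convex_Ico 0 1)
      (fun t ht => (hf t (hsub ht)).continuousAt.continuousWithinAt)
      (fun t ht => (hf t (hsub (interior_subset ht))).hasDerivWithinAt)
      (fun t ht => ?_) (by simp) ⟨h, hx'⟩ h
    exact mul_nonpos_of_nonpos_of_nonneg (by linarith [(interior_subset ht).1]) (hg t)
  · have hsub : Set.Ioc (-1 : ℝ) 0 ⊆ Set.Ioo (-1) 1 := fun t ht => ⟨ht.1, by linarith [ht.2]⟩
    refine monotoneOn_of_hasDerivWithinAt_nonneg (convex_Ioc (-1) 0)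
      (fun t ht => (hf t (hsub ht)).continuousAt.continuousWithinAt)
      (fun t ht => (hf t (hsub (interior_subset ht))).hasDerivWithinAt)
      (fun t ht => ?_) ⟨hx, h⟩ (by simp) h
    exact mul_nonneg (by linarith [(interior_subset ht).2]) (hg t)

open Polynomial in
theorem sq_eval_derivative_derivative_legendre_of_sq_eq_one (n : ℕ) {x : ℝ} (hx : x ^ 2 = 1) :
    (derivative (derivative (legendre n))).eval x ^ 2 =
      ((n : ℝ) * (n + 1) * (n * (n + 1) - 2) / 8) ^ 2 := by
  have h0 := eval_legendre_ode n x
  have h1 := eval_derivative_legendre_ode n x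
  rw [eval_legendre_of_sq_eq_one hx] at h0
  have hp : (x ^ n) ^ 2 = 1 := by rw [← pow_mul, mul_comm, pow_mul, hx, one_pow]
  have hy : (derivative (derivative (legendre n))).eval x =
      (n : ℝ) * (n + 1) * (n * (n + 1) - 2) / 8 * x ^ n := by
    set a := (derivative (legendre n)).eval x
    set b := (derivative (derivative (legendre n))).eval x
    set c := (derivative (derivative (derivative (legendre n)))).eval x
    rw [hx] at h0 h1
    linear_combination (x / 4) * h1 + ((n : ℝ) * (n + 1) - 2) / 8 * h0 - b * hx
  rw [hy, mul_pow, hp, mul_one]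

open Polynomial in
theorem sq_eval_derivative_derivative_legendre_le (n : ℕ) (hn : 3 ≤ n) {x : ℝ}
    (hx : -1 ≤ x) (hx' : x ≤ 1) :
    (derivative (derivative (legendre n))).eval x ^ 2 ≤
      ((n : ℝ) * (n + 1) * (n * (n + 1) - 2) / 8) ^ 2 := by
  set p := derivative (derivative (legendre n)) with hp
  have hn' : (3 : ℝ) ≤ n := by exact_mod_cast hn
  have hK : 0 < (n : ℝ) * (n + 1) - 6 := by nlinarith
  have hF := le_eval_endpoint_of_hasDerivAt_id_mul
    (f := fun t => ((n : ℝ) * (n + 1) - 6) * p.eval t ^ 2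
      + (1 - t ^ 2) * (derivative p).eval t ^ 2)
    (g := fun t => 10 * (derivative p).eval t ^ 2) (fun t => by
      have h := (((p.hasDerivAt t).pow 2).const_mul ((n : ℝ) * (n + 1) - 6)).add
        ((((hasDerivAt_id t).pow 2).const_sub 1).mul (((derivative p).hasDerivAt t).pow 2))
      refine h.congr_deriv ?_
      have ode := eval_derivative_derivative_legendre_ode n t
      rw [← hp] at ode
      simp
      linear_combination -2 * (derivative p).eval t * ode) (fun t => by positivity) hx hx'
  have hw : 0 ≤ (1 - x ^ 2) * (derivative p).eval x ^ 2 :=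
    mul_nonneg (by nlinarith) (sq_nonneg _)
  refine le_of_mul_le_mul_left ?_ hK
  rcases hF with h | h
  · rw [← sq_eval_derivative_derivative_legendre_of_sq_eq_one n (x := 1) (by norm_num)]
    norm_num at h
    linarith
  · rw [← sq_eval_derivative_derivative_legendre_of_sq_eq_one n (x := -1) (by norm_num)]
    norm_num at h
    linarith

open Polynomial in
/-- Sonin-type estimate for the second derivative of a Legendre polynomial away from the
endpoints. -/
theorem sonin_energy_le (n : ℕ) (hn : 1 ≤ n) {x : ℝ} (hx : -1 < x) (hx' : x < 1) :
    √(1 - x ^ 2) ^ 3 * (((n + 1 / 2 : ℝ) ^ 2 * (1 - x ^ 2) - 15 / 4) *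
        (derivative (derivative (legendre n))).eval x ^ 2) ≤
      2 * (n : ℝ) ^ 2 * (n + 1) * (n + 1 / 2) ^ 2 := by
  set p := derivative (derivative (legendre n)) with hp
  have hE := le_eval_zero_of_hasDerivAt_neg_id_mul
    (f := fun t => √(1 - t ^ 2) ^ 3 * (((n + 1 / 2 : ℝ) ^ 2 * (1 - t ^ 2) - 15 / 4) *
        p.eval t ^ 2 + ((1 - t ^ 2) * (derivative p).eval t - 5 / 2 * t * p.eval t) ^ 2))
    (g := fun t => 15 / 2 * √(1 - t ^ 2) * p.eval t ^ 2) (fun t ht => by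
      have hw : 0 < 1 - t ^ 2 := by nlinarith [ht.1, ht.2]
      have hr : 0 < √(1 - t ^ 2) := Real.sqrt_pos.2 hw
      have hr2 : √(1 - t ^ 2) ^ 2 = 1 - t ^ 2 := Real.sq_sqrt hw.le
      have dw : HasDerivAt (fun t : ℝ => 1 - t ^ 2) (-(2 * t)) t := by
        simpa using ((hasDerivAt_id t).pow 2).const_sub 1
      have dr := (dw.sqrt hw.ne').pow 3
      have d0 := p.hasDerivAt t
      have d1 := (derivative p).hasDerivAt t
      have dG := (((dw.const_mul ((n + 1 / 2 : ℝ) ^ 2)).sub_const (15 / 4)).mul (d0.pow 2)).add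
        (((dw.mul d1).sub (((hasDerivAt_id t).const_mul (5 / 2)).mul d0)).pow 2)
      refine (dr.mul dG).congr_deriv ?_
      have ode := eval_derivative_derivative_legendre_ode n t
      rw [← hp] at ode
      simp
      set r := √(1 - t ^ 2)
      set a := p.eval t
      set b := (derivative p).eval t
      set c := (derivative (derivative p)).eval t
      have e : 3 * r ^ 2 * (-(2 * t) / (2 * r)) = -3 * t * r := by field_simp
      rw [e, pow_succ r 2, hr2]
      linear_combination
        -2 * r * (1 - t ^ 2) * ((1 - t ^ 2) * b - 5 / 2 * t * a) * ode)
    (fun t => by positivity) hx hx'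
  have h0 := eval_legendre_ode n 0
  have h1 := eval_derivative_legendre_ode n 0
  rw [← hp] at h0 h1
  have ha : p.eval 0 = -((n : ℝ) * (n + 1)) * (legendre n).eval 0 := by linarith
  have hb : (derivative p).eval 0 =
      -((n : ℝ) * (n + 1) - 2) * (derivative (legendre n)).eval 0 := by linarith
  have hP := sq_eval_zero_legendre_le n
  have hP' : (derivative (legendre n)).eval 0 ^ 2 ≤ n := by
    cases n with
    | zero => simp [legendre]
    | succ n =>
      have h := congrArg (eval 0) (legendre_derivative_succ n).1
      have hP := sq_eval_zero_legendre_le n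
      simp at h
      rw [h, mul_pow]
      push_cast
      calc ((n : ℝ) + 1) ^ 2 * (legendre n).eval 0 ^ 2
          ≤ ((n : ℝ) + 1) ^ 2 * (1 / ((n : ℝ) + 1)) := by gcongr
        _ = (n : ℝ) + 1 := by field_simp
  have hE0 : √(1 - (0 : ℝ) ^ 2) ^ 3 * (((n + 1 / 2 : ℝ) ^ 2 * (1 - (0 : ℝ) ^ 2) - 15 / 4) *
        p.eval 0 ^ 2 + ((1 - (0 : ℝ) ^ 2) * (derivative p).eval 0 - 5 / 2 * 0 * p.eval 0) ^ 2)
      ≤ 2 * (n : ℝ) ^ 2 * (n + 1) * (n + 1 / 2) ^ 2 := by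
    have hn' : (1 : ℝ) ≤ n := by exact_mod_cast hn
    have hM : 0 ≤ (n : ℝ) * (n + 1) - 2 := by nlinarith
    calc _ = ((n + 1 / 2 : ℝ) ^ 2 - 15 / 4) * ((n : ℝ) * (n + 1)) ^ 2 * (legendre n).eval 0 ^ 2
            + ((n : ℝ) * (n + 1) - 2) ^ 2 * (derivative (legendre n)).eval 0 ^ 2 := by
          rw [ha, hb]; norm_num; ring
      _ ≤ (n + 1 / 2 : ℝ) ^ 2 * ((n : ℝ) * (n + 1)) ^ 2 * (1 / ((n : ℝ) + 1))
            + ((n : ℝ) * (n + 1)) ^ 2 * n := by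
          gcongr <;> linarith
      _ = (n : ℝ) ^ 2 * (n + 1) * ((n + 1 / 2) ^ 2 + n * (n + 1)) := by field_simp
      _ ≤ (n : ℝ) ^ 2 * (n + 1) * ((n + 1 / 2) ^ 2 + (n + 1 / 2) ^ 2) := by
          gcongr; nlinarith
      _ = _ := by ring
  have hnn : 0 ≤ √(1 - x ^ 2) ^ 3 *
      ((1 - x ^ 2) * (derivative p).eval x - 5 / 2 * x * p.eval x) ^ 2 := by positivity
  have := hE.trans hE0
  simp only [mul_add] at this
  linarith

open Polynomial in
theorem sq_eval_mul_sqrt_pow_le (n : ℕ) (hn : 2 ≤ n) {x : ℝ} (hx : -1 < x) (hx' : x < 1) :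
    (derivative (derivative (legendre n))).eval x ^ 2 * √(1 - x ^ 2) ^ 5 ≤ 10 * (n : ℝ) ^ 3 := by
  have hw : 0 < 1 - x ^ 2 := by nlinarith
  have hr : 0 < √(1 - x ^ 2) := Real.sqrt_pos.2 hw
  have hr2 : √(1 - x ^ 2) ^ 2 = 1 - x ^ 2 := Real.sq_sqrt hw.le
  have hr1 : √(1 - x ^ 2) ≤ 1 := Real.sqrt_le_one.2 (by nlinarith)
  have hE := sonin_energy_le n (by lia) hx hx'
  have hn' : (2 : ℝ) ≤ n := by exact_mod_cast hn
  rcases hn.eq_or_lt with rfl | h3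
  · have hy : (derivative (derivative (legendre 2))).eval x = 3 := by
      simp [legendre]; norm_num
    rw [hy]
    have := pow_le_one₀ (n := 5) hr.le hr1
    norm_num
    linarith
  have hy := sq_eval_derivative_derivative_legendre_le n h3 hx.le hx'.le
  set y := (derivative (derivative (legendre n))).eval x
  set r := √(1 - x ^ 2)
  rw [← hr2] at hE
  set N : ℝ := n + 1 / 2 with hN
  have hN0 : 0 < N := by positivity
  rcases le_total (N * r) (5 / 2) with h | h
  · have hyN : y ^ 2 ≤ (N ^ 4 / 8) ^ 2 := by
      refine hy.trans ?_
      have h1 : (0 : ℝ) ≤ n * (n + 1) - 2 := by nlinarith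
      have h2 : (n : ℝ) * (n + 1) ≤ N ^ 2 := by rw [hN]; nlinarith
      gcongr
      calc (n : ℝ) * (n + 1) * (n * (n + 1) - 2) ≤ N ^ 2 * N ^ 2 := by
            gcongr; linarith
        _ = N ^ 4 := by ring
    calc y ^ 2 * r ^ 5 ≤ (N ^ 4 / 8) ^ 2 * r ^ 5 := by gcongr
      _ = N ^ 3 * (N * r) ^ 5 / 64 := by ring
      _ ≤ (5 / 4 * n) ^ 3 * (5 / 2) ^ 5 / 64 := by
        gcongr
        rw [hN]; linarith
      _ ≤ 10 * (n : ℝ) ^ 3 := by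
        have : (0 : ℝ) ≤ (n : ℝ) ^ 3 := by positivity
        nlinarith
  · have h6 : 6 ≤ N ^ 2 * r ^ 2 := by nlinarith
    have h38 : 3 / 8 * (N ^ 2 * r ^ 2) ≤ N ^ 2 * r ^ 2 - 15 / 4 := by linarith
    have : N ^ 2 * (3 / 8 * (y ^ 2 * r ^ 5)) ≤ N ^ 2 * (2 * (n : ℝ) ^ 2 * (n + 1)) :=
      calc N ^ 2 * (3 / 8 * (y ^ 2 * r ^ 5)) = r ^ 3 * (3 / 8 * (N ^ 2 * r ^ 2) * y ^ 2) := by ring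
        _ ≤ r ^ 3 * ((N ^ 2 * r ^ 2 - 15 / 4) * y ^ 2) := by gcongr
        _ ≤ _ := hE
        _ = _ := by ring
    have h2 := le_of_mul_le_mul_left this (by positivity)
    have h3 : (n : ℝ) ^ 2 * (n + 1) ≤ n ^ 2 * (3 / 2 * n) := by gcongr; linarith
    have : (0 : ℝ) ≤ (n : ℝ) ^ 3 := by positivity
    nlinarith

open Polynomial in
/-- Envelope bound for the second derivative of the Legendre polynomial. -/
theorem legendre_second_deriv_envelope_bound (n : ℕ) (hn : 1 ≤ n) (x : ℝ)
    (hx : -1 < x) (hx' : x < 1) :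
    |(derivative (derivative (legendre n))).eval x| ≤
      2 ^ ((5 : ℝ) / 2) / Real.sqrt Real.pi *
        ((n : ℝ) ^ ((3 : ℝ) / 2) / (1 - x ^ 2) ^ ((5 : ℝ) / 4)) := by
  rcases hn.eq_or_lt with rfl | h2
  · simp only [legendre, derivative_X, derivative_one, eval_zero, abs_zero]
    have hw : 0 ≤ 1 - x ^ 2 := by nlinarith
    positivity
  have hw : 0 < 1 - x ^ 2 := by nlinarith
  have hW : 0 < (1 - x ^ 2) ^ ((5 : ℝ) / 4) := by positivity
  rw [← mul_div_assoc, le_div_iff₀ hW]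
  refine le_of_abs_le (abs_le_of_sq_le_sq ?_ (by positivity))
  have e1 : ((1 - x ^ 2) ^ ((5 : ℝ) / 4)) ^ 2 = √(1 - x ^ 2) ^ 5 := by
    rw [Real.sqrt_eq_rpow, ← Real.rpow_mul_natCast hw.le, ← Real.rpow_mul_natCast hw.le]
    norm_num
  have e2 : ((2 : ℝ) ^ ((5 : ℝ) / 2)) ^ 2 = 32 := by
    rw [← Real.rpow_natCast, ← Real.rpow_mul (by norm_num)]
    norm_num
  have e3 : ((n : ℝ) ^ ((3 : ℝ) / 2)) ^ 2 = (n : ℝ) ^ 3 := by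
    rw [← Real.rpow_natCast, ← Real.rpow_natCast, ← Real.rpow_mul (by positivity)]
    norm_num
  rw [mul_pow, mul_pow, div_pow, sq_abs, e1, e2, e3, Real.sq_sqrt Real.pi_pos.le]
  refine (sq_eval_mul_sqrt_pow_le n h2 hx hx').trans ?_
  gcongr
  rw [le_div_iff₀ Real.pi_pos]
  linarith [Real.pi_lt_d2]
end

section
/- For real x ≥ 1 with u = (x−1)/2, the Legendre polynomial satisfies P_n(x) ≤ 2·I_0(2n√u) ≤ 2·e^{2n√u}, where I_0 is the modified Bessel function of the first kind. -/
/-- The modified Bessel function of the first kind of order 0. -/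
noncomputable def besselI0 (z : ℝ) : ℝ :=
  ∑' k : ℕ, (z / 2) ^ (2 * k) / ((k.factorial : ℝ)) ^ 2

/-- The product `∏_{j < k} (t - j) (t + j + 1)`, which for `t = n` equals `(n + k)! / (n - k)!`. -/
noncomputable def centralProd (t : ℝ) (k : ℕ) : ℝ :=
  ∏ j ∈ Finset.range k, (t - j) * (t + j + 1)

lemma centralProd_zero (t : ℝ) : centralProd t 0 = 1 := by
  simp [centralProd]

lemma centralProd_succ (t : ℝ) (k : ℕ) :
    centralProd t (k + 1) = centralProd t k * ((t - k) * (t + k + 1)) := by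
  simp [centralProd, Finset.prod_range_succ]

lemma centralProd_eq_zero {n k : ℕ} (h : n < k) : centralProd n k = 0 :=
  Finset.prod_eq_zero (Finset.mem_range.2 h) (by simp)

lemma centralProd_succ_eq_shift_up (t : ℝ) (k : ℕ) :
    centralProd t (k + 1) = centralProd (t + 1) k * ((t - k) * (t + 1 - k)) := by
  induction k with
  | zero => simp [centralProd]
  | succ k ih =>
    rw [centralProd_succ, ih, centralProd_succ (t + 1) k]
    push_cast
    ring

lemma centralProd_add_one_succ (t : ℝ) (k : ℕ) :
    centralProd (t + 1) (k + 1) = centralProd t k * ((t + k + 1) * (t + k + 2)) := by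
  induction k with
  | zero => simp only [zero_add, centralProd, Finset.prod_range_one, Finset.prod_range_zero]; push_cast; ring
  | succ k ih =>
    rw [centralProd_succ, ih, centralProd_succ t k]
    push_cast
    ring

lemma centralProd_three_term (t : ℝ) (k : ℕ) :
    (t + 2) * centralProd (t + 2) (k + 1) =
      (2 * t + 3) * (centralProd (t + 1) (k + 1) + 2 * (k + 1) ^ 2 * centralProd (t + 1) k)
        - (t + 1) * centralProd t (k + 1) := by
  rw [show t + 2 = t + 1 + 1 by ring, centralProd_add_one_succ, centralProd_succ (t + 1),
    centralProd_succ_eq_shift_up t]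
  ring

lemma centralProd_le {n k : ℕ} (h : k ≤ n) : centralProd n k ≤ 2 * (n : ℝ) ^ (2 * k) := by
  rcases Nat.eq_zero_or_pos n with rfl | hn
  · obtain rfl : k = 0 := by omega
    norm_num [centralProd]
  have hn' : (0 : ℝ) < n := by exact_mod_cast hn
  have key : ∀ k ≤ n, (n : ℝ) * centralProd n k ≤ (n + k) * (n : ℝ) ^ (2 * k) := by
    intro k
    induction k with
    | zero => simp [centralProd]
    | succ k ih =>
      intro hk
      have hkn : (k : ℝ) ≤ n := by exact_mod_cast (Nat.le_succ k).trans hk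
      have hfac : (0 : ℝ) ≤ (n - k) * (n + k + 1) :=
        mul_nonneg (sub_nonneg.2 hkn) (by positivity)
      calc (n : ℝ) * centralProd n (k + 1)
          = n * centralProd n k * ((n - k) * (n + k + 1)) := by rw [centralProd_succ]; ring
        _ ≤ (n + k) * (n : ℝ) ^ (2 * k) * ((n - k) * (n + k + 1)) :=
            mul_le_mul_of_nonneg_right (ih (by omega)) hfac
        _ = ((n : ℝ) ^ 2 - k ^ 2) * ((n : ℝ) ^ (2 * k) * (n + k + 1)) := by ring
        _ ≤ (n : ℝ) ^ 2 * ((n : ℝ) ^ (2 * k) * (n + k + 1)) := by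
            gcongr
            linarith [sq_nonneg (k : ℝ)]
        _ = (n + (k + 1 : ℕ)) * (n : ℝ) ^ (2 * (k + 1)) := by push_cast; ring
  have hkn : (k : ℝ) ≤ n := by exact_mod_cast h
  refine le_of_mul_le_mul_left ((key k h).trans ?_) hn'
  calc (n + k) * (n : ℝ) ^ (2 * k) ≤ (n + n) * (n : ℝ) ^ (2 * k) := by gcongr
    _ = n * (2 * (n : ℝ) ^ (2 * k)) := by ring

/-- Expansion of the Legendre polynomials around `1`. -/
lemma legendre_eval_one_add (u : ℝ) (n N : ℕ) (h : n < N) :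
    (legendre n).eval (1 + 2 * u) =
      ∑ k ∈ Finset.range N, centralProd n k / (k.factorial : ℝ) ^ 2 * u ^ k := by
  obtain ⟨M, rfl⟩ : ∃ M, N = M + 1 := ⟨N - 1, by omega⟩
  induction n using Nat.twoStepInduction with
  | zero =>
    rw [Finset.sum_range_succ', Finset.sum_eq_zero]
    · simp [legendre, centralProd]
    · intro k _
      rw [centralProd_eq_zero (Nat.succ_pos k)]
      simp
  | one =>
    obtain ⟨L, rfl⟩ : ∃ L, M = L + 1 := ⟨M - 1, by omega⟩
    rw [Finset.sum_range_succ', Finset.sum_range_succ', Finset.sum_eq_zero]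
    · simp [legendre, centralProd]
      ring
    · intro k _
      rw [centralProd_eq_zero (by omega)]
      simp
  | more n ih₀ ih₁ =>
    have e₀ := ih₀ (by omega)
    have e₁ := ih₁ (by omega)
    have e₁' := e₁
    rw [Finset.sum_range_succ, centralProd_eq_zero (show n + 1 < M by omega)] at e₁'
    rw [Finset.sum_range_succ'] at e₀ e₁ ⊢
    simp only [centralProd_zero, zero_div, zero_mul, add_zero, Nat.factorial_zero, Nat.cast_one,
      one_pow, div_one, pow_zero, mul_one] at e₀ e₁ e₁' ⊢
    have hn : (n : ℝ) + 2 ≠ 0 := by positivity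
    have hrec : ((n : ℝ) + 2) * (legendre (n + 2)).eval (1 + 2 * u) =
        (2 * n + 3) * ((legendre (n + 1)).eval (1 + 2 * u)
          + 2 * u * (legendre (n + 1)).eval (1 + 2 * u))
          - (n + 1) * (legendre n).eval (1 + 2 * u) := by
      simp only [legendre, Polynomial.eval_sub, Polynomial.eval_mul, Polynomial.eval_C,
        Polynomial.eval_X]
      field_simp
    apply mul_left_cancel₀ hn
    rw [hrec, e₀]
    nth_rewrite 2 [e₁']
    rw [e₁]
    have hsum : ((n : ℝ) + 2) * ∑ k ∈ Finset.range M,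
          centralProd (n + 2 : ℕ) (k + 1) / ((k + 1).factorial : ℝ) ^ 2 * u ^ (k + 1) =
        (2 * n + 3) * (∑ k ∈ Finset.range M,
          centralProd (n + 1 : ℕ) (k + 1) / ((k + 1).factorial : ℝ) ^ 2 * u ^ (k + 1)
          + 2 * u * ∑ k ∈ Finset.range M,
            centralProd (n + 1 : ℕ) k / (k.factorial : ℝ) ^ 2 * u ^ k)
        - (n + 1) * ∑ k ∈ Finset.range M,
          centralProd n (k + 1) / ((k + 1).factorial : ℝ) ^ 2 * u ^ (k + 1) := by
      simp only [Finset.mul_sum, ← Finset.sum_add_distrib, ← Finset.sum_sub_distrib]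
      refine Finset.sum_congr rfl fun k _ => ?_
      have hrel := centralProd_three_term n k
      have hk : (k.factorial : ℝ) ≠ 0 := by positivity
      have hk1 : (k : ℝ) + 1 ≠ 0 := by positivity
      rw [Nat.factorial_succ]
      push_cast
      field_simp
      linear_combination u ^ (k + 1) * hrel
    linear_combination -hsum

lemma besselI0_term_le {w : ℝ} (hw : 0 ≤ w) (k : ℕ) :
    w ^ (2 * k) / (k.factorial : ℝ) ^ 2 ≤ w ^ k / k.factorial * Real.exp w := by
  have h := mul_le_mul_of_nonneg_left (Real.pow_div_factorial_le_exp w hw k)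
    (show 0 ≤ w ^ k / k.factorial by positivity)
  refine le_of_eq_of_le ?_ h
  rw [div_mul_div_comm, ← pow_add, ← two_mul, sq]

lemma hasSum_pow_div_factorial_mul_exp (w : ℝ) :
    HasSum (fun k : ℕ => w ^ k / k.factorial * Real.exp w) (Real.exp w * Real.exp w) := by
  have h := NormedSpace.expSeries_div_hasSum_exp w
  rw [← Real.exp_eq_exp_ℝ] at h
  exact h.mul_right _

lemma besselI0_summable {z : ℝ} (hz : 0 ≤ z) :
    Summable fun k : ℕ => (z / 2) ^ (2 * k) / (k.factorial : ℝ) ^ 2 :=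
  (hasSum_pow_div_factorial_mul_exp (z / 2)).summable.of_nonneg_of_le
    (fun k => by positivity) (besselI0_term_le (by positivity))

lemma besselI0_le_exp {z : ℝ} (hz : 0 ≤ z) : besselI0 z ≤ Real.exp z := by
  have h := hasSum_pow_div_factorial_mul_exp (z / 2)
  rw [← Real.exp_add, add_halves] at h
  exact hasSum_le (besselI0_term_le (by positivity)) (besselI0_summable hz).hasSum h

/-- Bound on Legendre polynomials for arguments x ≥ 1. -/
theorem legendre_bessel_bound (n : ℕ) (x : ℝ) (hx : 1 ≤ x) :
    (legendre n).eval x ≤ 2 * besselI0 (2 * (n : ℝ) * Real.sqrt ((x - 1) / 2)) ∧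
      2 * besselI0 (2 * (n : ℝ) * Real.sqrt ((x - 1) / 2)) ≤
        2 * Real.exp (2 * (n : ℝ) * Real.sqrt ((x - 1) / 2)) := by
  have hu : 0 ≤ (x - 1) / 2 := by linarith
  have hz : 0 ≤ 2 * (n : ℝ) * Real.sqrt ((x - 1) / 2) := by positivity
  refine ⟨?_, mul_le_mul_of_nonneg_left (besselI0_le_exp hz) zero_le_two⟩
  have hexp := legendre_eval_one_add ((x - 1) / 2) n (n + 1) n.lt_succ_self
  rw [show 1 + 2 * ((x - 1) / 2) = x by ring] at hexp
  rw [hexp]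
  refine le_trans ?_ (mul_le_mul_of_nonneg_left
    ((besselI0_summable hz).sum_le_tsum (Finset.range (n + 1)) fun k _ => by positivity)
    zero_le_two)
  rw [Finset.mul_sum]
  refine Finset.sum_le_sum fun k hk => ?_
  rw [show 2 * (n : ℝ) * Real.sqrt ((x - 1) / 2) / 2 = n * Real.sqrt ((x - 1) / 2) by ring,
    mul_pow, pow_mul (Real.sqrt _), Real.sq_sqrt hu]
  calc centralProd n k / (k.factorial : ℝ) ^ 2 * ((x - 1) / 2) ^ k
      ≤ 2 * (n : ℝ) ^ (2 * k) / (k.factorial : ℝ) ^ 2 * ((x - 1) / 2) ^ k := by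
        gcongr
        exact centralProd_le (Nat.lt_succ_iff.1 (Finset.mem_range.1 hk))
    _ = 2 * ((n : ℝ) ^ (2 * k) * ((x - 1) / 2) ^ k / (k.factorial : ℝ) ^ 2) := by ring
end
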